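/- Let R : V ⇝ V be a linear relation on a finite-dimensional vector space. For all sufficiently large k, dom(R^k) = D₊ and im(R^k) = D₋. -/

import Mathlib

variable {A V : Type*} [CommRing A] [AddCommGroup V] [Module A V]

/-- `K₊`: elements admitting a finite forward `R`-chain ending at `0`:
`v R v₁ R v₂ R ⋯ R v_k R 0`. -/
def KplusSet (R : Submodule A (V × V)) : Set V :=
  {v | ∃ (n : ℕ) (c : ℕ → V), c 0 = v ∧ c (n + 1) = 0 ∧ ∀ i ≤ n, (c i, c (i + 1)) ∈ R}

/-- `K₋`: elements reached from `0` by a finite forward `R`-chain: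
`0 R v_{-k} R ⋯ R v_{-1} R v`. -/
def KminusSet (R : Submodule A (V × V)) : Set V :=
  {v | ∃ (n : ℕ) (c : ℕ → V), c 0 = 0 ∧ c (n + 1) = v ∧ ∀ i ≤ n, (c i, c (i + 1)) ∈ R}

/-- `D₊`: elements admitting an infinite forward `R`-chain `v R v₁ R v₂ R ⋯`. -/
def DplusSet (R : Submodule A (V × V)) : Set V :=
  {v | ∃ c : ℕ → V, c 0 = v ∧ ∀ i, (c i, c (i + 1)) ∈ R}

/-- `D₋`: elements admitting an infinite backward `R`-chain `⋯ R v₂ R v₁ R v`. -/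
def DminusSet (R : Submodule A (V × V)) : Set V :=
  {v | ∃ c : ℕ → V, c 0 = v ∧ ∀ i, (c (i + 1), c i) ∈ R}

/-- Composition of linear relations: `v (rcomp R S) u` iff `∃ w, v R w` and `w S u`. -/
def rcomp {A V W U : Type*} [CommRing A] [AddCommGroup V] [Module A V]
    [AddCommGroup W] [Module A W] [AddCommGroup U] [Module A U]
    (R : Submodule A (V × W)) (S : Submodule A (W × U)) : Submodule A (V × U) where
  carrier := {p | ∃ w, (p.1, w) ∈ R ∧ (w, p.2) ∈ S}
  add_mem' := by
    rintro a b ⟨w1, h1, h1'⟩ ⟨w2, h2, h2'⟩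
    exact ⟨w1 + w2, R.add_mem h1 h2, S.add_mem h1' h2'⟩
  zero_mem' := ⟨0, R.zero_mem, S.zero_mem⟩
  smul_mem' := by
    rintro c a ⟨w, h, h'⟩
    exact ⟨c • w, R.smul_mem c h, S.smul_mem c h'⟩

/-- The `k`-fold composition `R^k` of a linear relation `R : V ⇝ V` with itself
(`R^0` is the identity relation). -/
def relPow {A V : Type*} [CommRing A] [AddCommGroup V] [Module A V]
    (R : Submodule A (V × V)) : ℕ → Submodule A (V × V)
  | 0 => LinearMap.graph (LinearMap.id : V →ₗ[A] V)
  | n + 1 => rcomp (relPow R n) R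

theorem mem_relPow_succ {R : Submodule A (V × V)} {n : ℕ} {v w : V} :
    (v, w) ∈ relPow R (n + 1) ↔ ∃ u, (v, u) ∈ relPow R n ∧ (u, w) ∈ R :=
  Iff.rfl

theorem mem_relPow_zero {R : Submodule A (V × V)} {v w : V} :
    (v, w) ∈ relPow R 0 ↔ w = v := by
  simp [relPow]

theorem mem_relPow_succ' {R : Submodule A (V × V)} {n : ℕ} {v w : V} :
    (v, w) ∈ relPow R (n + 1) ↔ ∃ u, (v, u) ∈ R ∧ (u, w) ∈ relPow R n := by
  induction n generalizing w with
  | zero => simp [mem_relPow_succ, mem_relPow_zero]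
  | succ n ih =>
    rw [mem_relPow_succ]
    constructor
    · rintro ⟨x, hx, hxw⟩
      obtain ⟨u, hu, hux⟩ := ih.1 hx
      exact ⟨u, hu, x, hux, hxw⟩
    · rintro ⟨u, hu, x, hux, hxw⟩
      exact ⟨x, ih.2 ⟨u, hu, hux⟩, hxw⟩

/-- The converse of a linear relation. -/
def relConverse (R : Submodule A (V × V)) : Submodule A (V × V) :=
  R.comap (LinearEquiv.prodComm A V V).toLinearMap

theorem mem_relConverse {R : Submodule A (V × V)} {v w : V} :
    (v, w) ∈ relConverse R ↔ (w, v) ∈ R :=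
  Iff.rfl

theorem mem_relPow_relConverse {R : Submodule A (V × V)} {n : ℕ} {v w : V} :
    (v, w) ∈ relPow (relConverse R) n ↔ (w, v) ∈ relPow R n := by
  induction n generalizing w with
  | zero => simp [mem_relPow_zero, eq_comm]
  | succ n ih => simp only [mem_relPow_succ, ih, mem_relConverse, ← mem_relPow_succ', and_comm]

/-- The domain of the `k`-fold composition of a linear relation, as a submodule. -/
def relPowDom (R : Submodule A (V × V)) (k : ℕ) : Submodule A V :=
  (relPow R k).map (LinearMap.fst A V V)

theorem mem_relPowDom {R : Submodule A (V × V)} {k : ℕ} {v : V} :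
    v ∈ relPowDom R k ↔ ∃ w, (v, w) ∈ relPow R k := by
  simp [relPowDom]

theorem mem_relPowDom_succ {R : Submodule A (V × V)} {k : ℕ} {v : V} :
    v ∈ relPowDom R (k + 1) ↔ ∃ u ∈ relPowDom R k, (v, u) ∈ R := by
  simp only [mem_relPowDom, mem_relPow_succ']
  grind

theorem relPowDom_antitone (R : Submodule A (V × V)) : Antitone (relPowDom R) := by
  refine antitone_nat_of_succ_le fun k v hv ↦ ?_
  obtain ⟨w, u, hu, -⟩ := mem_relPowDom.1 hv
  exact mem_relPowDom.2 ⟨u, hu⟩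

theorem relPow_of_chain {R : Submodule A (V × V)} {c : ℕ → V}
    (hc : ∀ i, (c i, c (i + 1)) ∈ R) (k : ℕ) : (c 0, c k) ∈ relPow R k := by
  induction k with
  | zero => exact mem_relPow_zero.2 rfl
  | succ k ih => exact ⟨c k, ih, hc k⟩

theorem subset_DplusSet {R : Submodule A (V × V)} {S : Set V}
    (hS : ∀ v ∈ S, ∃ u ∈ S, (v, u) ∈ R) : S ⊆ DplusSet R := by
  intro v hv
  choose f hf hfR using hS
  let c : ℕ → S := fun n ↦ (fun x : S ↦ ⟨f x x.2, hf x x.2⟩)^[n] ⟨v, hv⟩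
  refine ⟨fun n ↦ c n, rfl, fun i ↦ ?_⟩
  simp only [c, Function.iterate_succ_apply']
  exact hfR _ _

theorem exists_forall_dom_relPow_eq_DplusSet [IsArtinian A V] (R : Submodule A (V × V)) :
    ∃ N : ℕ, ∀ k ≥ N, {v : V | ∃ w, (v, w) ∈ relPow R k} = DplusSet R := by
  obtain ⟨N, hN⟩ := IsArtinian.monotone_stabilizes
    ⟨fun k ↦ OrderDual.toDual (relPowDom R k), fun _ _ h ↦ relPowDom_antitone R h⟩
  replace hN : ∀ k ≥ N, relPowDom R N = relPowDom R k := hN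
  refine ⟨N, fun k hk ↦ Set.Subset.antisymm ?_ ?_⟩
  · refine subset_DplusSet fun v hv ↦ ?_
    have hv' : v ∈ relPowDom R (k + 1) := by
      rw [← hN (k + 1) (by omega), hN k hk]
      exact mem_relPowDom.2 hv
    obtain ⟨u, hu, hvu⟩ := mem_relPowDom_succ.1 hv'
    exact ⟨u, mem_relPowDom.1 hu, hvu⟩
  · rintro _ ⟨c, rfl, hc⟩
    exact ⟨c k, relPow_of_chain hc k⟩

/-- For a linear relation `R` on a finite-dimensional vector space and all sufficiently
large `k`, `dom (R^k) = D₊` and `im (R^k) = D₋`. -/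
theorem stmt9 {κ V : Type*} [Field κ] [AddCommGroup V] [Module κ V] [FiniteDimensional κ V]
    (R : Submodule κ (V × V)) :
    ∃ N : ℕ, ∀ k ≥ N,
      {v : V | ∃ w, (v, w) ∈ relPow R k} = DplusSet R
      ∧ {w : V | ∃ v, (v, w) ∈ relPow R k} = DminusSet R := by
  obtain ⟨N, hN⟩ := exists_forall_dom_relPow_eq_DplusSet R
  obtain ⟨M, hM⟩ := exists_forall_dom_relPow_eq_DplusSet (relConverse R)
  refine ⟨max N M, fun k hk ↦ ⟨hN k (le_of_max_le_left hk), ?_⟩⟩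
  have h := hM k (le_of_max_le_right hk)
  simp only [mem_relPow_relConverse] at h
  exact h
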